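/- Let θ : g̃₋* → gl(W) be a ℂ-linear Lie algebra homomorphism on a finite-dimensional complex vector space W such that W is irreducible as a module over the real subalgebra ũ := {ι(T,K,0,0) : T ∈ o(ν), K ∈ u(r)} (acting via θ). Then there exist finite-dimensional irreducible ℂ-linear representations (θ₁, V₁) of gl(ν,ℂ) and (θ₂, V₂) of sl(r,ℂ), a constant c₂ ∈ ℂ, and a ℂ-linear isomorphism W ≅ V₁ ⊗ V₂ under which, for all T₁,T₂ ∈ gl(ν,ℝ), K₁,K₂ ∈ u(r), V ∈ Mat_{ν,r}(ℂ): θ(ι(T₁,K₁,V,T₂+T₂ᵀ) + i·ι(T₂,K₂,i·conj(V),−T₁−T₁ᵀ)) = θ₁(T₁+iT₂) ⊗ id_{V₂} + id_{V₁} ⊗ θ₂((K₁+iK₂) − (tr(K₁+iK₂)/r)·I_r) + c₂·tr(K₁+iK₂)·id_{V₁⊗V₂}. In particular θ vanishes on the elements with T₁=T₂=0, K₁=K₂=0 and arbitrary V. -/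

import Mathlib

open Matrix

/-- The block-matrix embedding `ι(T,K,V,U) ∈ Mat_{2(ν+r)}(ℝ)`, with row/column block
sizes `(r, ν, r, ν)`:
`[[Re K, 0, −Im K, Re Vᵀ], [Im V, T, Re V, U], [Im K, 0, Re K, −Im Vᵀ], [0,0,0,−Tᵀ]]`. -/
def iota (ν r : ℕ) (T : Matrix (Fin ν) (Fin ν) ℝ) (K : Matrix (Fin r) (Fin r) ℂ)
    (V : Matrix (Fin ν) (Fin r) ℂ) (U : Matrix (Fin ν) (Fin ν) ℝ) :
    Matrix ((Fin r ⊕ Fin ν) ⊕ (Fin r ⊕ Fin ν)) ((Fin r ⊕ Fin ν) ⊕ (Fin r ⊕ Fin ν)) ℝ :=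
  Matrix.fromBlocks
    (Matrix.fromBlocks (K.map Complex.re) 0 (V.map Complex.im) T)
    (Matrix.fromBlocks (-(K.map Complex.im)) (Vᵀ.map Complex.re) (V.map Complex.re) U)
    (Matrix.fromBlocks (K.map Complex.im) 0 0 0)
    (Matrix.fromBlocks (K.map Complex.re) (-(Vᵀ.map Complex.im)) 0 (-Tᵀ))

/-- The Lie algebra `g̃`: the set of all matrices `ι(T,K,V,U)` with
`T ∈ gl(ν,ℝ)`, `K ∈ u(r)` (skew-Hermitian), `V ∈ Mat_{ν,r}(ℂ)`, `U ∈ Sym_ν(ℝ)`. -/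
def gtilde (ν r : ℕ) :
    Set (Matrix ((Fin r ⊕ Fin ν) ⊕ (Fin r ⊕ Fin ν)) ((Fin r ⊕ Fin ν) ⊕ (Fin r ⊕ Fin ν)) ℝ) :=
  {X | ∃ T K V U, Kᴴ = -K ∧ U.IsSymm ∧ X = iota ν r T K V U}

/-- The generic element
`ι(T₁,K₁,V,T₂+T₂ᵀ) + i·ι(T₂,K₂,i·conj V, −T₁−T₁ᵀ)` of the complex Lie algebra
`g̃₋* ⊂ gl(2(ν+r),ℂ)`. -/
noncomputable def gmElt (ν r : ℕ) (T₁ T₂ : Matrix (Fin ν) (Fin ν) ℝ)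
    (K₁ K₂ : Matrix (Fin r) (Fin r) ℂ) (V : Matrix (Fin ν) (Fin r) ℂ) :
    Matrix ((Fin r ⊕ Fin ν) ⊕ (Fin r ⊕ Fin ν)) ((Fin r ⊕ Fin ν) ⊕ (Fin r ⊕ Fin ν)) ℂ :=
  (iota ν r T₁ K₁ V (T₂ + T₂ᵀ)).map (fun a => (a : ℂ)) +
    Complex.I •
      (iota ν r T₂ K₂ (Complex.I • V.map (starRingEnd ℂ)) (-(T₁ + T₁ᵀ))).map
        (fun a => (a : ℂ))

/-- The complex Lie subalgebra `g̃₋* ⊂ gl(2(ν+r),ℂ)`. -/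
noncomputable def gminusStar (ν r : ℕ) :
    Set (Matrix ((Fin r ⊕ Fin ν) ⊕ (Fin r ⊕ Fin ν)) ((Fin r ⊕ Fin ν) ⊕ (Fin r ⊕ Fin ν)) ℂ) :=
  {X | ∃ T₁ T₂ K₁ K₂ V, K₁ᴴ = -K₁ ∧ K₂ᴴ = -K₂ ∧ X = gmElt ν r T₁ T₂ K₁ K₂ V}


noncomputable def gmMat (ν r : ℕ) (T : Matrix (Fin ν) (Fin ν) ℂ) (K : Matrix (Fin r) (Fin r) ℂ) :
    Matrix ((Fin r ⊕ Fin ν) ⊕ (Fin r ⊕ Fin ν)) ((Fin r ⊕ Fin ν) ⊕ (Fin r ⊕ Fin ν)) ℂ :=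
  Matrix.fromBlocks
    (Matrix.fromBlocks ((1/2 : ℂ) • (K - Kᵀ)) 0 0 T)
    (Matrix.fromBlocks ((Complex.I/2) • (K + Kᵀ)) 0 0 (-Complex.I • (T + Tᵀ)))
    (Matrix.fromBlocks ((-Complex.I/2) • (K + Kᵀ)) 0 0 0)
    (Matrix.fromBlocks ((1/2 : ℂ) • (K - Kᵀ)) 0 0 (-Tᵀ))

lemma gmMat_add (ν r : ℕ) (T S K L) : gmMat ν r (T + S) (K + L) = gmMat ν r T K + gmMat ν r S L := by
  simp only [gmMat, fromBlocks_add, transpose_add]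
  congr 2 <;> module

lemma gmMat_smul (ν r : ℕ) (c : ℂ) (T K) : gmMat ν r (c • T) (c • K) = c • gmMat ν r T K := by
  simp only [gmMat, fromBlocks_smul, transpose_smul]
  congr 2 <;> module

lemma gmMat_brk (ν r : ℕ) (T S K L) :
    gmMat ν r T K * gmMat ν r S L - gmMat ν r S L * gmMat ν r T K
      = gmMat ν r (T * S - S * T) (K * L - L * K) := by
  have hI : Complex.I * Complex.I = -1 := Complex.I_mul_I
  simp only [gmMat, fromBlocks_multiply, sub_eq_add_neg, fromBlocks_neg, fromBlocks_add,
    transpose_add, transpose_neg, transpose_mul]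
  congr 2
  all_goals simp only [Matrix.mul_zero, Matrix.zero_mul, add_zero, zero_add, neg_zero, smul_add, smul_neg,
    Matrix.add_mul, Matrix.mul_add, Matrix.smul_mul, Matrix.mul_smul, Matrix.mul_neg, Matrix.neg_mul, smul_smul]
  all_goals match_scalars <;> ring_nf <;> simp [Complex.I_sq] <;> norm_num

lemma skewH_transpose {r : ℕ} {K : Matrix (Fin r) (Fin r) ℂ} (h : Kᴴ = -K) : Kᵀ = -(K.map star) := by
  have h' := congrArg (fun M : Matrix (Fin r) (Fin r) ℂ => -(M.map star)) h
  ext i j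
  have := congrFun (congrFun h' i) j
  simp at this ⊢
  rw [← this]; simp

lemma gmElt_eq (ν r : ℕ) (T₁ T₂ : Matrix (Fin ν) (Fin ν) ℝ)
    (K₁ K₂ : Matrix (Fin r) (Fin r) ℂ) (h1 : K₁ᴴ = -K₁) (h2 : K₂ᴴ = -K₂) (V) :
    gmElt ν r T₁ T₂ K₁ K₂ V = gmMat ν r (T₁.map (fun a => (a : ℂ)) + Complex.I • T₂.map (fun a => (a : ℂ)))
      (K₁ + Complex.I • K₂) + gmElt ν r 0 0 0 0 V := by
  have e1 := skewH_transpose h1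
  have e2 := skewH_transpose h2
  rw [gmMat, transpose_add, transpose_smul, e1, e2]
  ext i j
  rcases i with (i | i) | (i | i) <;> rcases j with (j | j) | (j | j) <;>
    simp [gmElt, iota, Complex.ext_iff] <;>
    first | done | (constructor <;> ring) | ring

lemma gmElt_V_real_T (ν r : ℕ) (V) :
    gmMat ν r 1 0 * gmElt ν r 0 0 0 0 V - gmElt ν r 0 0 0 0 V * gmMat ν r 1 0 = gmElt ν r 0 0 0 0 V := by
  simp only [gmMat, gmElt, iota, fromBlocks_map, fromBlocks_smul, fromBlocks_add, fromBlocks_multiply, sub_eq_add_neg, fromBlocks_neg]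
  congr 2 <;> (ext i j; simp)

lemma mem_V (ν r : ℕ) (V) : gmElt ν r 0 0 0 0 V ∈ gminusStar ν r :=
  ⟨0,0,0,0,V, by simp, by simp, rfl⟩

lemma gmElt_zero (ν r : ℕ) : gmElt ν r 0 0 0 0 0 = 0 := by
  ext i j
  rcases i with (i | i) | (i | i) <;> rcases j with (j | j) | (j | j) <;>
    simp [gmElt, iota]

lemma mem_gmMat (ν r : ℕ) (T K) : gmMat ν r T K ∈ gminusStar ν r := by
  refine ⟨T.map Complex.re, T.map Complex.im, (1/2 : ℂ) • (K - Kᴴ), (-Complex.I/2) • (K + Kᴴ), 0, ?_, ?_, ?_⟩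
  · simp [conjTranspose_smul]; module
  · simp [conjTranspose_smul, add_comm]; module
  · rw [gmElt_eq, gmElt_zero, add_zero]
    · congr 1
      · ext i j; simp [Complex.ext_iff]
      · rw [smul_smul, show Complex.I * (-Complex.I/2) = 1/2 by linear_combination (-1/2) * Complex.I_mul_I]
        module
    · simp [conjTranspose_smul]; module
    · simp [conjTranspose_smul, add_comm]; module

open TensorProduct in
lemma ev_bij {W : Type*} [AddCommGroup W] [Module ℂ W] [FiniteDimensional ℂ W]
    (A : Type*) [Ring A] [Algebra ℂ A] [Module A W] [IsScalarTower ℂ A W]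
    (S : Type*) [AddCommGroup S] [Module ℂ S] [Module A S] [IsScalarTower ℂ A S]
    [FiniteDimensional ℂ S] [IsSimpleModule A S]
    (ev : S ⊗[ℂ] (S →ₗ[A] W) →ₗ[ℂ] W) (hev : ∀ v f, ev (v ⊗ₜ f) = f v) :
    Function.Injective ev := by
  have schur := IsSimpleModule.algebraMap_end_bijective_of_isAlgClosed (A := A) (V := S) ℂ
  have dens : ∀ g : S →ₗ[ℂ] S, ∃ x : A, ∀ v, g v = x • v := by
    intro g
    let G : Module.End (Module.End A S) S :=
      { toFun := g, map_add' := g.map_add, map_smul' := by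
          intro h v
          obtain ⟨c, rfl⟩ := schur.2 h
          simp }
    let B := Module.finBasis ℂ S
    classical
    obtain ⟨x, hx⟩ := jacobson_density (R := A) G (Finset.univ.image B)
    refine ⟨x, fun v => ?_⟩
    have : g = (Algebra.lsmul ℂ ℂ S x : S →ₗ[ℂ] S) := by
      apply B.ext
      intro i
      exact hx (B i) (by simp)
    rw [this]; rfl
  rw [← LinearMap.ker_eq_bot, LinearMap.ker_eq_bot']
  intro t ht
  let B := Module.finBasis ℂ S
  classical
  have key : ∀ u : S ⊗[ℂ] (S →ₗ[A] W), ∃ f : Fin (Module.finrank ℂ S) → (S →ₗ[A] W),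
      u = ∑ i, B i ⊗ₜ f i := by
    intro u
    induction u using TensorProduct.induction_on with
    | zero => exact ⟨0, by simp⟩
    | tmul v f =>
      refine ⟨fun i => B.repr v i • f, ?_⟩
      conv_lhs => rw [← B.sum_repr v]
      simp only [TensorProduct.sum_tmul, TensorProduct.smul_tmul]
    | add s t hs ht' =>
      obtain ⟨f, rfl⟩ := hs
      obtain ⟨g, rfl⟩ := ht'
      exact ⟨f + g, by simp [TensorProduct.tmul_add, Finset.sum_add_distrib]⟩
  obtain ⟨f, rfl⟩ := key t
  have hf : ∀ i, f i = 0 := by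
    intro i
    simp only [map_sum, hev] at ht
    have hj : ∀ j, f i (B j) = 0 := by
      intro j
      obtain ⟨x, hx⟩ := dens (B.constr ℂ (fun k => if k = i then B j else 0))
      have := congrArg (fun w => x • w) ht
      simp only [Finset.smul_sum, ← map_smul, ← hx, Module.Basis.constr_basis, smul_zero] at this
      rw [Finset.sum_eq_single i] at this
      · simpa using this
      · intro k _ hk; simp [hk]
      · simp
    have : (f i).restrictScalars ℂ = 0 := B.ext (by simpa using hj)
    ext v
    exact congrArg (fun g => g v) this
  simp [hf]

open TensorProduct in
lemma core_decomp {W : Type*} [AddCommGroup W] [Module ℂ W] [FiniteDimensional ℂ W]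
    {M N : Type*} [AddCommGroup M] [Module ℂ M] [AddCommGroup N] [Module ℂ N]
    (a : M →ₗ[ℂ] Module.End ℂ W) (b : N →ₗ[ℂ] Module.End ℂ W)
    (hirr : ∀ p : Submodule ℂ W, (∀ x, ∀ w ∈ p, a x w ∈ p) → (∀ y, ∀ w ∈ p, b y w ∈ p) →
      p = ⊥ ∨ p = ⊤)
    (A : Type*) [Ring A] [Algebra ℂ A] [Module A W] [IsScalarTower ℂ A W]
    (S : Type*) [AddCommGroup S] [Module ℂ S] [Module A S] [IsScalarTower ℂ A S]
    [FiniteDimensional ℂ S] [IsSimpleModule A S]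
    (aA : M →ₗ[ℂ] A) (haA : ∀ x (w : W), aA x • w = a x w)
    (hcomm : ∀ (y : N) (z : A) (w : W), b y (z • w) = z • b y w)
    (j : S →ₗ[A] W) (hj : j ≠ 0) :
    ∃ (d₁ d₂ : ℕ) (θ₁ : M →ₗ[ℂ] Module.End ℂ (Fin d₁ → ℂ))
      (θ₂ : N →ₗ[ℂ] Module.End ℂ (Fin d₂ → ℂ))
      (e : W ≃ₗ[ℂ] (Fin d₁ → ℂ) ⊗[ℂ] (Fin d₂ → ℂ)),
      (∀ x w, e (a x w) = LinearMap.rTensor _ (θ₁ x) (e w)) ∧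
      (∀ y w, e (b y w) = LinearMap.lTensor _ (θ₂ y) (e w)) := by
  have hfd2 : FiniteDimensional ℂ (S →ₗ[A] W) :=
    Module.Finite.of_injective (LinearMap.restrictScalarsₗ ℂ A S W ℂ) <|
    LinearMap.restrictScalars_injective _
  let a₁ : M →ₗ[ℂ] Module.End ℂ S :=
    { toFun := fun x => (Algebra.lsmul ℂ ℂ S (aA x) : S →ₗ[ℂ] S)
      map_add' := by
        intro x y; ext v
        simp
      map_smul' := by
        intro c x; ext v
        simp }
  let bA : N → (W →ₗ[A] W) := fun y =>
    { toFun := b y, map_add' := (b y).map_add, map_smul' := hcomm y }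
  let b₁ : N →ₗ[ℂ] Module.End ℂ (S →ₗ[A] W) :=
    { toFun := fun y =>
        { toFun := fun f => (bA y).comp f
          map_add' := by intro f g; ext v; simp [bA]
          map_smul' := by intro c f; ext v; simp [bA] }
      map_add' := by intro x y; ext f v; simp [bA]
      map_smul' := by intro x y; ext f v; simp [bA] }
  let ev : S ⊗[ℂ] (S →ₗ[A] W) →ₗ[ℂ] W := TensorProduct.lift
    (LinearMap.flip (LinearMap.restrictScalarsₗ ℂ A S W ℂ))
  have hev : ∀ v f, ev (v ⊗ₜ f) = f v := fun v f => by simp [ev]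
  have eva : ∀ x t, ev ((a₁ x).rTensor _ t) = a x (ev t) := by
    intro x t
    induction t using TensorProduct.induction_on with
    | zero => simp
    | tmul v f =>
      rw [LinearMap.rTensor_tmul, hev, hev]
      exact (f.map_smul (aA x) v).trans (haA x _)
    | add s t h h' => simp only [map_add, h, h']
  have evb : ∀ y t, ev ((b₁ y).lTensor _ t) = b y (ev t) := by
    intro x t
    induction t using TensorProduct.induction_on with
    | zero => simp
    | tmul v f =>
      rw [LinearMap.lTensor_tmul, hev, hev]
      rfl
    | add s t h h' => simp only [map_add, h, h']
  have hinj := ev_bij A S ev hev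
  have hsurj : Function.Surjective ev := by
    rw [← LinearMap.range_eq_top]
    refine (hirr _ ?_ ?_).resolve_left ?_
    · rintro x _ ⟨t, rfl⟩; exact ⟨_, eva x t⟩
    · rintro x _ ⟨t, rfl⟩; exact ⟨_, evb x t⟩
    · intro h
      apply hj
      ext v
      have : ev (v ⊗ₜ j) ∈ LinearMap.range ev := ⟨_, rfl⟩
      rw [h, hev] at this
      exact this
  let E := LinearEquiv.ofBijective ev ⟨hinj, hsurj⟩
  let E₁ := (Module.finBasis ℂ S).equivFun
  let E₂ := (Module.finBasis ℂ (S →ₗ[A] W)).equivFun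
  refine ⟨_, _, E₁.conj.toLinearMap ∘ₗ a₁, E₂.conj.toLinearMap ∘ₗ b₁,
    E.symm ≪≫ₗ TensorProduct.congr E₁ E₂, ?_, ?_⟩
  · intro x w
    obtain ⟨t, rfl⟩ := E.surjective w
    have : a x (E t) = E ((a₁ x).rTensor _ t) := (eva x t).symm
    rw [this]
    simp only [LinearEquiv.trans_apply, LinearEquiv.symm_apply_apply]
    induction t using TensorProduct.induction_on with
    | zero => simp
    | tmul v f => simp [LinearEquiv.conj_apply]
    | add s t h h' => simp only [map_add, h (eva x s).symm, h' (eva x t).symm]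
  · intro x w
    obtain ⟨t, rfl⟩ := E.surjective w
    have : b x (E t) = E ((b₁ x).lTensor _ t) := (evb x t).symm
    rw [this]
    simp only [LinearEquiv.trans_apply, LinearEquiv.symm_apply_apply]
    induction t using TensorProduct.induction_on with
    | zero => simp
    | tmul v f => simp [LinearEquiv.conj_apply]
    | add s t h h' => simp only [map_add, h (evb x s).symm, h' (evb x t).symm]

open TensorProduct in
lemma abs_decomp {W : Type*} [AddCommGroup W] [Module ℂ W] [FiniteDimensional ℂ W] [Nontrivial W]
    {M N : Type*} [AddCommGroup M] [Module ℂ M] [AddCommGroup N] [Module ℂ N]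
    (a : M →ₗ[ℂ] Module.End ℂ W) (b : N →ₗ[ℂ] Module.End ℂ W)
    (hab : ∀ x y w, a x (b y w) = b y (a x w))
    (hirr : ∀ p : Submodule ℂ W, (∀ x, ∀ w ∈ p, a x w ∈ p) → (∀ y, ∀ w ∈ p, b y w ∈ p) →
      p = ⊥ ∨ p = ⊤) :
    ∃ (d₁ d₂ : ℕ) (θ₁ : M →ₗ[ℂ] Module.End ℂ (Fin d₁ → ℂ))
      (θ₂ : N →ₗ[ℂ] Module.End ℂ (Fin d₂ → ℂ))
      (e : W ≃ₗ[ℂ] (Fin d₁ → ℂ) ⊗[ℂ] (Fin d₂ → ℂ)),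
      (∀ x w, e (a x w) = LinearMap.rTensor _ (θ₁ x) (e w)) ∧
      (∀ y w, e (b y w) = LinearMap.lTensor _ (θ₂ y) (e w)) := by
  let A : Subalgebra ℂ (Module.End ℂ W) := Algebra.adjoin ℂ (Set.range a)
  have hart : IsArtinian A W := isArtinian_of_tower ℂ inferInstance
  obtain ⟨S, hS, -⟩ := (IsAtomic.eq_bot_or_exists_atom_le (⊤ : Submodule A W)).resolve_left
    top_ne_bot
  have hsimp : IsSimpleModule A S := isSimpleModule_iff_isAtom.2 hS
  have hfd : FiniteDimensional ℂ S :=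
    FiniteDimensional.finiteDimensional_submodule (S.restrictScalars ℂ)
  let aA : M →ₗ[ℂ] A :=
    { toFun := fun x => ⟨a x, Algebra.subset_adjoin ⟨x, rfl⟩⟩
      map_add' := fun x y => Subtype.ext (a.map_add x y)
      map_smul' := fun x y => Subtype.ext (a.map_smul x y) }
  have hcomm : ∀ (y : N) (z : A) (w : W), b y (z • w) = z • b y w := by
    rintro y ⟨z, hz⟩ w
    change b y (z w) = z (b y w)
    induction hz using Algebra.adjoin_induction generalizing w with
    | mem z hz => obtain ⟨x, rfl⟩ := hz; exact (hab x y w).symm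
    | algebraMap c => simp [Module.algebraMap_end_apply]
    | add z z' _ _ h h' => simp [h, h']
    | mul z z' _ _ h h' => simp [h, h']
  refine core_decomp a b hirr A S aA (fun x w => rfl) hcomm S.subtype ?_
  intro h
  apply hS.1
  rw [eq_bot_iff]
  intro v hv
  exact congrArg (fun g => g ⟨v, hv⟩) h

open TensorProduct in
lemma tmul_zero_or {d₁ d₂ : ℕ} (v : Fin d₁ → ℂ) (u : Fin d₂ → ℂ) (h : v ⊗ₜ[ℂ] u = 0) :
    v = 0 ∨ u = 0 := by
  by_contra! hn
  obtain ⟨i, hi⟩ := Function.ne_iff.1 hn.1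
  obtain ⟨j, hj⟩ := Function.ne_iff.1 hn.2
  have := congrArg (LinearMap.mul' ℂ ℂ ∘ₗ TensorProduct.map (LinearMap.proj i) (LinearMap.proj j)) h
  simp at this
  rcases this with h | h
  · exact hi h
  · exact hj h

open TensorProduct in
lemma schur_scalar {W : Type*} [AddCommGroup W] [Module ℂ W] [FiniteDimensional ℂ W] [Nontrivial W]
    {M N : Type*} [AddCommGroup M] [Module ℂ M] [AddCommGroup N] [Module ℂ N]
    (a : M →ₗ[ℂ] Module.End ℂ W) (b : N →ₗ[ℂ] Module.End ℂ W)
    (hirr : ∀ p : Submodule ℂ W, (∀ x, ∀ w ∈ p, a x w ∈ p) → (∀ y, ∀ w ∈ p, b y w ∈ p) →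
      p = ⊥ ∨ p = ⊤) (z : Module.End ℂ W) (ha : ∀ x, a x * z = z * a x)
    (hb : ∀ x, b x * z = z * b x) : ∃ c : ℂ, z = c • 1 := by
  obtain ⟨c, hc⟩ := Module.End.exists_eigenvalue z
  refine ⟨c, ?_⟩
  have := (hirr (Module.End.eigenspace z c) ?_ ?_).resolve_left hc
  · ext w
    have hw : w ∈ Module.End.eigenspace z c := this ▸ Submodule.mem_top
    simpa using Module.End.mem_eigenspace_iff.1 hw
  · intro x w hw
    rw [Module.End.mem_eigenspace_iff] at hw ⊢
    rw [← Module.End.mul_apply, ← ha, Module.End.mul_apply, hw, map_smul]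
  · intro x w hw
    rw [Module.End.mem_eigenspace_iff] at hw ⊢
    rw [← Module.End.mul_apply, ← hb, Module.End.mul_apply, hw, map_smul]


open TensorProduct in
lemma irr_left {d₁ d₂ : ℕ} [Nontrivial (Fin d₂ → ℂ)] (p : Submodule ℂ (Fin d₁ → ℂ))
    (h : LinearMap.range (LinearMap.rTensor (Fin d₂ → ℂ) p.subtype) = ⊥ ∨
      LinearMap.range (LinearMap.rTensor (Fin d₂ → ℂ) p.subtype) = ⊤) : p = ⊥ ∨ p = ⊤ := by
  obtain ⟨u, hu⟩ := exists_ne (0 : Fin d₂ → ℂ)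
  rcases h with h | h
  · left
    rw [eq_bot_iff]
    intro v hv
    have : v ⊗ₜ[ℂ] u ∈ LinearMap.range (LinearMap.rTensor (Fin d₂ → ℂ) p.subtype) :=
      ⟨⟨v, hv⟩ ⊗ₜ u, by simp⟩
    rw [h] at this
    exact (tmul_zero_or _ _ this).resolve_right hu
  · right
    have h0 : LinearMap.rTensor (Fin d₂ → ℂ) p.mkQ = 0 := by
      apply TensorProduct.ext'
      intro v w
      have : v ⊗ₜ[ℂ] w ∈ LinearMap.range (LinearMap.rTensor (Fin d₂ → ℂ) p.subtype) := h ▸ trivial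
      obtain ⟨t, ht⟩ := this
      rw [← ht, ← LinearMap.comp_apply, ← LinearMap.rTensor_comp]
      have : p.mkQ ∘ₗ p.subtype = 0 := by ext; simp
      rw [this]; simp
    rw [← Module.FaithfullyFlat.zero_iff_rTensor_zero] at h0
    rw [← Submodule.ker_mkQ p, h0, LinearMap.ker_zero]

open TensorProduct in
lemma irr_right {d₁ d₂ : ℕ} [Nontrivial (Fin d₁ → ℂ)] (p : Submodule ℂ (Fin d₂ → ℂ))
    (h : LinearMap.range (LinearMap.lTensor (Fin d₁ → ℂ) p.subtype) = ⊥ ∨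
      LinearMap.range (LinearMap.lTensor (Fin d₁ → ℂ) p.subtype) = ⊤) : p = ⊥ ∨ p = ⊤ := by
  obtain ⟨u, hu⟩ := exists_ne (0 : Fin d₁ → ℂ)
  rcases h with h | h
  · left
    rw [eq_bot_iff]
    intro v hv
    have : u ⊗ₜ[ℂ] v ∈ LinearMap.range (LinearMap.lTensor (Fin d₁ → ℂ) p.subtype) :=
      ⟨u ⊗ₜ ⟨v, hv⟩, by simp⟩
    rw [h] at this
    exact (tmul_zero_or _ _ this).resolve_left hu
  · right
    have h0 : LinearMap.lTensor (Fin d₁ → ℂ) p.mkQ = 0 := by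
      apply TensorProduct.ext'
      intro v w
      have : v ⊗ₜ[ℂ] w ∈ LinearMap.range (LinearMap.lTensor (Fin d₁ → ℂ) p.subtype) := h ▸ trivial
      obtain ⟨t, ht⟩ := this
      rw [← ht, ← LinearMap.comp_apply, ← LinearMap.lTensor_comp]
      have : p.mkQ ∘ₗ p.subtype = 0 := by ext; simp
      rw [this]; simp
    rw [← Module.FaithfullyFlat.zero_iff_lTensor_zero] at h0
    rw [← Submodule.ker_mkQ p, h0, LinearMap.ker_zero]

lemma comap_bot_or_top {W X : Type*} [AddCommGroup W] [Module ℂ W] [AddCommGroup X] [Module ℂ X]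
    (e : W ≃ₗ[ℂ] X) (q : Submodule ℂ X)
    (h : q.comap e.toLinearMap = ⊥ ∨ q.comap e.toLinearMap = ⊤) : q = ⊥ ∨ q = ⊤ := by
  have key : ∀ x ∈ q, e.symm x ∈ q.comap e.toLinearMap := fun x hx => by simpa using hx
  rcases h with h | h
  · left
    rw [eq_bot_iff]
    intro x hx
    have := key x hx
    rw [h] at this
    simpa using this
  · right
    rw [eq_top_iff]
    intro x _
    have : e.symm x ∈ q.comap e.toLinearMap := h ▸ trivial
    simpa using this

open TensorProduct in
/-- The decomposition with irreducibility and brackets. -/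
lemma full_decomp {W : Type*} [AddCommGroup W] [Module ℂ W] [FiniteDimensional ℂ W] [Nontrivial W]
    {M N : Type*} [AddCommGroup M] [Module ℂ M] [AddCommGroup N] [Module ℂ N]
    (a : M →ₗ[ℂ] Module.End ℂ W) (b : N →ₗ[ℂ] Module.End ℂ W)
    (hab : ∀ x y w, a x (b y w) = b y (a x w))
    (hirr : ∀ p : Submodule ℂ W, (∀ x, ∀ w ∈ p, a x w ∈ p) → (∀ y, ∀ w ∈ p, b y w ∈ p) →
      p = ⊥ ∨ p = ⊤) :
    ∃ (d₁ d₂ : ℕ) (θ₁ : M →ₗ[ℂ] Module.End ℂ (Fin d₁ → ℂ))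
      (θ₂ : N →ₗ[ℂ] Module.End ℂ (Fin d₂ → ℂ))
      (e : W ≃ₗ[ℂ] (Fin d₁ → ℂ) ⊗[ℂ] (Fin d₂ → ℂ)),
      (∀ x w, e (a x w) = LinearMap.rTensor _ (θ₁ x) (e w)) ∧
      (∀ y w, e (b y w) = LinearMap.lTensor _ (θ₂ y) (e w)) ∧
      (∀ x y z, a x = a y * a z - a z * a y → θ₁ x = θ₁ y * θ₁ z - θ₁ z * θ₁ y) ∧
      (∀ x y z, b x = b y * b z - b z * b y → θ₂ x = θ₂ y * θ₂ z - θ₂ z * θ₂ y) ∧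
      (∀ p : Submodule ℂ (Fin d₁ → ℂ), (∀ x, ∀ w ∈ p, θ₁ x w ∈ p) → p = ⊥ ∨ p = ⊤) ∧
      (∀ p : Submodule ℂ (Fin d₂ → ℂ), (∀ x, ∀ w ∈ p, θ₂ x w ∈ p) → p = ⊥ ∨ p = ⊤) ∧
      (∀ x (c : ℂ), b x = c • 1 → θ₂ x = c • 1) := by
  obtain ⟨d₁, d₂, θ₁, θ₂, e, h1, h2⟩ := abs_decomp a b hab hirr
  have hn1 : Nontrivial (Fin d₁ → ℂ) := by
    by_contra hn
    rw [not_nontrivial_iff_subsingleton] at hn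
    exact not_subsingleton W e.toEquiv.subsingleton
  have hn2 : Nontrivial (Fin d₂ → ℂ) := by
    by_contra hn
    rw [not_nontrivial_iff_subsingleton] at hn
    exact not_subsingleton W e.toEquiv.subsingleton
  have inj1 : ∀ f g : Module.End ℂ (Fin d₁ → ℂ), (∀ w, LinearMap.rTensor (Fin d₂ → ℂ) f (e w)
      = LinearMap.rTensor (Fin d₂ → ℂ) g (e w)) → f = g := by
    intro f g h
    rw [← sub_eq_zero, Module.FaithfullyFlat.zero_iff_rTensor_zero ℂ (Fin d₂ → ℂ),
      LinearMap.rTensor_sub]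
    refine LinearMap.ext fun t => ?_
    obtain ⟨w, rfl⟩ := e.surjective t
    rw [LinearMap.sub_apply, h w, sub_self, LinearMap.zero_apply]
  have inj2 : ∀ f g : Module.End ℂ (Fin d₂ → ℂ), (∀ w, LinearMap.lTensor (Fin d₁ → ℂ) f (e w)
      = LinearMap.lTensor (Fin d₁ → ℂ) g (e w)) → f = g := by
    intro f g h
    rw [← sub_eq_zero, Module.FaithfullyFlat.zero_iff_lTensor_zero ℂ (Fin d₁ → ℂ),
      LinearMap.lTensor_sub]
    refine LinearMap.ext fun t => ?_
    obtain ⟨w, rfl⟩ := e.surjective t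
    rw [LinearMap.sub_apply, h w, sub_self, LinearMap.zero_apply]
  refine ⟨d₁, d₂, θ₁, θ₂, e, h1, h2, ?_, ?_, ?_, ?_, ?_⟩
  · intro x y z h
    apply inj1
    intro w
    rw [← h1, h, LinearMap.rTensor_sub, LinearMap.rTensor_mul, LinearMap.rTensor_mul]
    simp [h1]
  · intro x y z h
    apply inj2
    intro w
    rw [← h2, h, LinearMap.lTensor_sub, LinearMap.lTensor_mul, LinearMap.lTensor_mul]
    simp [h2]
  · intro p hp
    apply irr_left (d₂ := d₂)
    apply comap_bot_or_top e
    apply hirr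
    · rintro x w ⟨t, ht⟩
      let g : p →ₗ[ℂ] p := (θ₁ x).restrict (hp x)
      refine ⟨LinearMap.rTensor _ g t, ?_⟩
      have hg : p.subtype ∘ₗ g = θ₁ x ∘ₗ p.subtype := by ext; rfl
      change _ = e (a x w)
      rw [h1, ← LinearMap.comp_apply, ← LinearMap.rTensor_comp, hg, LinearMap.rTensor_comp,
        LinearMap.comp_apply, ht]
      rfl
    · rintro y w ⟨t, ht⟩
      refine ⟨LinearMap.lTensor _ (θ₂ y) t, ?_⟩
      change _ = e (b y w)
      rw [h2, ← LinearMap.comp_apply, LinearMap.rTensor_comp_lTensor,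
        ← LinearMap.lTensor_comp_rTensor, LinearMap.comp_apply, ht]
      rfl
  · intro p hp
    apply irr_right (d₁ := d₁)
    apply comap_bot_or_top e
    apply hirr
    · rintro y w ⟨t, ht⟩
      refine ⟨LinearMap.rTensor _ (θ₁ y) t, ?_⟩
      change _ = e (a y w)
      rw [h1, ← LinearMap.comp_apply, LinearMap.lTensor_comp_rTensor,
        ← LinearMap.rTensor_comp_lTensor, LinearMap.comp_apply, ht]
      rfl
    · rintro x w ⟨t, ht⟩
      let g : p →ₗ[ℂ] p := (θ₂ x).restrict (hp x)
      refine ⟨LinearMap.lTensor _ g t, ?_⟩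
      have hg : p.subtype ∘ₗ g = θ₂ x ∘ₗ p.subtype := by ext; rfl
      change _ = e (b x w)
      rw [h2, ← LinearMap.comp_apply, ← LinearMap.lTensor_comp, hg, LinearMap.lTensor_comp,
        LinearMap.comp_apply, ht]
      rfl
  · intro x c h
    apply inj2
    intro w
    rw [← h2, h, LinearMap.lTensor_smul]
    simp [Module.End.one_eq_id]

/-- a ℂ-linear Lie algebra homomorphism `θ : g̃₋* → gl(W)` on a
finite-dimensional complex space `W` which is irreducible over the real subalgebra
`ũ = {ι(T,K,0,0) : T ∈ o(ν), K ∈ u(r)}` decomposes, under some isomorphism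
`W ≅ V₁ ⊗ V₂`, as `θ₁(T₁+iT₂) ⊗ 1 + 1 ⊗ θ₂((K₁+iK₂)₀) + c₂·tr(K₁+iK₂)·1`, with
`(θ₁,V₁)`, `(θ₂,V₂)` finite-dimensional irreducible representations of `gl(ν,ℂ)` and
`sl(r,ℂ)`; in particular `θ` vanishes on the elements with `T₁=T₂=0`, `K₁=K₂=0`. -/
theorem gminusStar_rep_tensor_decomposition (ν r : ℕ) (hν : 0 < ν) (hr : 0 < r)
    (W : Type*) [AddCommGroup W] [Module ℂ W] [FiniteDimensional ℂ W]
    (θ : Matrix ((Fin r ⊕ Fin ν) ⊕ (Fin r ⊕ Fin ν)) ((Fin r ⊕ Fin ν) ⊕ (Fin r ⊕ Fin ν)) ℂ →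
      Module.End ℂ W)
    (hadd : ∀ X ∈ gminusStar ν r, ∀ Y ∈ gminusStar ν r, θ (X + Y) = θ X + θ Y)
    (hsmul : ∀ (c : ℂ), ∀ X ∈ gminusStar ν r, θ (c • X) = c • θ X)
    (hbrk : ∀ X ∈ gminusStar ν r, ∀ Y ∈ gminusStar ν r,
      θ (X * Y - Y * X) = θ X * θ Y - θ Y * θ X)
    (hirr : ∀ p : Submodule ℂ W,
      (∀ (T : Matrix (Fin ν) (Fin ν) ℝ) (K : Matrix (Fin r) (Fin r) ℂ),
        Tᵀ = -T → Kᴴ = -K → ∀ w ∈ p, θ (gmElt ν r T 0 K 0 0) w ∈ p) →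
      p = ⊥ ∨ p = ⊤) :
    ∃ (d₁ d₂ : ℕ)
      (θ₁ : Matrix (Fin ν) (Fin ν) ℂ →ₗ[ℂ] Module.End ℂ (Fin d₁ → ℂ))
      (θ₂ : Matrix (Fin r) (Fin r) ℂ →ₗ[ℂ] Module.End ℂ (Fin d₂ → ℂ))
      (c₂ : ℂ)
      (e : W ≃ₗ[ℂ] TensorProduct ℂ (Fin d₁ → ℂ) (Fin d₂ → ℂ)),
      (∀ A B : Matrix (Fin ν) (Fin ν) ℂ,
        θ₁ (A * B - B * A) = θ₁ A * θ₁ B - θ₁ B * θ₁ A) ∧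
      (∀ p : Submodule ℂ (Fin d₁ → ℂ),
        (∀ A, ∀ w ∈ p, θ₁ A w ∈ p) → p = ⊥ ∨ p = ⊤) ∧
      (∀ A B : Matrix (Fin r) (Fin r) ℂ, A.trace = 0 → B.trace = 0 →
        θ₂ (A * B - B * A) = θ₂ A * θ₂ B - θ₂ B * θ₂ A) ∧
      (∀ p : Submodule ℂ (Fin d₂ → ℂ),
        (∀ A, A.trace = 0 → ∀ w ∈ p, θ₂ A w ∈ p) → p = ⊥ ∨ p = ⊤) ∧
      (∀ (T₁ T₂ : Matrix (Fin ν) (Fin ν) ℝ) (K₁ K₂ : Matrix (Fin r) (Fin r) ℂ)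
          (V : Matrix (Fin ν) (Fin r) ℂ), K₁ᴴ = -K₁ → K₂ᴴ = -K₂ →
        ∀ w : W,
          e (θ (gmElt ν r T₁ T₂ K₁ K₂ V) w) =
            LinearMap.rTensor (Fin d₂ → ℂ)
                (θ₁ (T₁.map (fun a => (a : ℂ)) + Complex.I • T₂.map (fun a => (a : ℂ))))
              (e w) +
            LinearMap.lTensor (Fin d₁ → ℂ)
                (θ₂ ((K₁ + Complex.I • K₂) -
                  ((K₁ + Complex.I • K₂).trace / (r : ℂ)) • 1))
              (e w) +
            (c₂ * (K₁ + Complex.I • K₂).trace) • (e w)) ∧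
      (∀ V : Matrix (Fin ν) (Fin r) ℂ, θ (gmElt ν r 0 0 0 0 V) = 0) := by
  rcases subsingleton_or_nontrivial W with hW | hW
  · refine ⟨0, 0, 0, 0, 0, LinearEquiv.ofSubsingleton _ _, ?_, ?_, ?_, ?_, ?_, ?_⟩
    · intros; exact Subsingleton.elim _ _
    · intros; left; exact Subsingleton.elim _ _
    · intros; exact Subsingleton.elim _ _
    · intros; left; exact Subsingleton.elim _ _
    · intros; exact Subsingleton.elim _ _
    · intros; exact Subsingleton.elim _ _
  let a : Matrix (Fin ν) (Fin ν) ℂ →ₗ[ℂ] Module.End ℂ W :=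
    { toFun := fun T => θ (gmMat ν r T 0)
      map_add' := fun T S => by
        rw [← hadd _ (mem_gmMat ν r _ _) _ (mem_gmMat ν r _ _), ← gmMat_add, add_zero]
      map_smul' := fun c T => by
        rw [RingHom.id_apply, ← hsmul _ _ (mem_gmMat ν r _ _), ← gmMat_smul, smul_zero] }
  let b : Matrix (Fin r) (Fin r) ℂ →ₗ[ℂ] Module.End ℂ W :=
    { toFun := fun K => θ (gmMat ν r 0 K)
      map_add' := fun T S => by
        rw [← hadd _ (mem_gmMat ν r _ _) _ (mem_gmMat ν r _ _), ← gmMat_add, add_zero]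
      map_smul' := fun c T => by
        rw [RingHom.id_apply, ← hsmul _ _ (mem_gmMat ν r _ _), ← gmMat_smul, smul_zero] }
  have hθ : ∀ T K, θ (gmMat ν r T K) = a T + b K := fun T K => by
    change _ = θ (gmMat ν r T 0) + θ (gmMat ν r 0 K)
    rw [← hadd _ (mem_gmMat ν r _ _) _ (mem_gmMat ν r _ _), ← gmMat_add, add_zero, zero_add]
  have hbr : ∀ T S K L, a (T * S - S * T) + b (K * L - L * K) =
      (a T + b K) * (a S + b L) - (a S + b L) * (a T + b K) := fun T S K L => by
    rw [← hθ, ← gmMat_brk, hbrk _ (mem_gmMat ν r _ _) _ (mem_gmMat ν r _ _), hθ, hθ]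
  have hba : ∀ T S, a (T * S - S * T) = a T * a S - a S * a T := fun T S => by
    simpa using hbr T S 0 0
  have hbb : ∀ T S, b (T * S - S * T) = b T * b S - b S * b T := fun T S => by
    simpa using hbr 0 0 T S
  have hcom : ∀ T K, a T * b K = b K * a T := fun T K => by
    have := hbr T 0 0 K
    simp only [mul_zero, zero_mul, sub_zero, map_zero, add_zero, zero_add] at this
    exact (sub_eq_zero.1 this.symm)
  have hirr0 : ∀ p : Submodule ℂ W,
      (∀ T : Matrix (Fin ν) (Fin ν) ℝ, Tᵀ = -T →
        ∀ w ∈ p, a (T.map (fun a => (a : ℂ))) w ∈ p) →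
      (∀ y, ∀ w ∈ p, b y w ∈ p) → p = ⊥ ∨ p = ⊤ := by
    intro p h1 h2
    apply hirr
    intro T K hT hK w hw
    rw [gmElt_eq ν r T 0 K 0 hK (by simp), gmElt_zero, add_zero, hθ]
    have e1 : T.map (fun a => (a : ℂ)) + Complex.I • (0 : Matrix (Fin ν) (Fin ν) ℝ).map
        (fun a => (a : ℂ)) = T.map (fun a => (a : ℂ)) := by ext; simp
    rw [e1]
    exact p.add_mem (h1 T hT w hw) (h2 _ w hw)
  have hirr' : ∀ p : Submodule ℂ W, (∀ x, ∀ w ∈ p, a x w ∈ p) → (∀ y, ∀ w ∈ p, b y w ∈ p) →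
      p = ⊥ ∨ p = ⊤ := fun p h1 h2 => hirr0 p (fun T _ => h1 _) h2
  obtain ⟨c, hc⟩ := schur_scalar a b hirr' (a 1)
    (fun x => by have := hba x 1; simp only [mul_one, one_mul, sub_self, map_zero] at this
                 exact sub_eq_zero.1 this.symm)
    (fun y => (hcom 1 y).symm)
  obtain ⟨s, hs⟩ := schur_scalar a b hirr' (b 1) (fun x => hcom x 1)
    (fun x => by have := hbb x 1; simp only [mul_one, one_mul, sub_self, map_zero] at this
                 exact sub_eq_zero.1 this.symm)
  have hV : ∀ V, θ (gmElt ν r 0 0 0 0 V) = 0 := by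
    intro V
    have := hbrk _ (mem_gmMat ν r 1 0) _ (mem_V ν r V)
    rw [gmElt_V_real_T, hθ, hc, map_zero, add_zero] at this
    simpa using this
  obtain ⟨d₁, d₂, θ₁, θ₂, e, h1, h2, hl1, hl2, hi1, hi2, hsc⟩ := full_decomp a b
    (fun x y w => congrArg (fun g => g w) (hcom x y)) hirr'
  have hr0 : (r : ℂ) ≠ 0 := by exact_mod_cast hr.ne'
  have hs2 := hsc 1 s hs
  have hdec : ∀ K : Matrix (Fin r) (Fin r) ℂ,
      θ₂ K = θ₂ (K - (K.trace / (r : ℂ)) • 1) + (s / r * K.trace) • 1 := by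
    intro K
    rw [map_sub, map_smul, hs2, smul_smul, sub_add, show K.trace / (r : ℂ) * s = s / r * K.trace by ring]
    simp
  refine ⟨d₁, d₂, θ₁, θ₂, s / r, e, fun A B => hl1 _ _ _ (hba A B), hi1,
    fun A B _ _ => hl2 _ _ _ (hbb A B), ?_, ?_, hV⟩
  · intro p hp
    apply hi2
    intro K w hw
    rw [hdec, LinearMap.add_apply]
    refine p.add_mem (hp _ ?_ w hw) ?_
    · simp [trace_sub, trace_smul, div_mul_cancel₀ _ hr0]
    · simpa using p.smul_mem _ hw
  · intro T₁ T₂ K₁ K₂ V hK₁ hK₂ w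
    rw [gmElt_eq ν r T₁ T₂ K₁ K₂ hK₁ hK₂ V, hadd _ (mem_gmMat ν r _ _) _ (mem_V ν r V), hV, add_zero,
      hθ, LinearMap.add_apply, map_add, h1, h2, hdec, LinearMap.lTensor_add, LinearMap.add_apply,
      LinearMap.lTensor_smul, add_assoc]
    simp [Module.End.one_eq_id]
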